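/- Let B₀ ∈ ℝ, μ > 0, and T > 0. With φ(s,t) = s + (μ/2)·sin(s)·(e^{(B₀−1)t} − e^{−(B₀+1)t}) and z(s,t) = B₀ t + (μ/2)·cos(s)·(e^{(B₀−1)t} + e^{−(B₀+1)t}), the magnetic term in the energy identity evaluates to ∫₀^T ∫₀^{2π} B₀·(∂ₛz·∂ₜφ − ∂ₜz·∂ₛφ) ds dt = −2π B₀² T + B₀·(π μ²/4)·(e^{−2T(1+B₀)} − e^{−2T(1−B₀)}). -/

import Mathlib

/-- The first angular coordinate of the torus heat flow solution with non-contractible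
initial curve: `φ(s,t) = s + (μ/2)·sin s·(e^{(B₀−1)t} − e^{−(B₀+1)t})`. -/
noncomputable def torusPhi' (B₀ μ : ℝ) (s t : ℝ) : ℝ :=
  s + (μ / 2) * Real.sin s * (Real.exp ((B₀ - 1) * t) - Real.exp (-((B₀ + 1) * t)))

/-- The second angular coordinate of the torus heat flow solution with non-contractible
initial curve: `z(s,t) = B₀t + (μ/2)·cos s·(e^{(B₀−1)t} + e^{−(B₀+1)t})`. -/
noncomputable def torusZ' (B₀ μ : ℝ) (s t : ℝ) : ℝ :=
  B₀ * t + (μ / 2) * Real.cos s * (Real.exp ((B₀ - 1) * t) + Real.exp (-((B₀ + 1) * t)))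

theorem hasDerivAt_torusPhi'_left (B₀ μ s t : ℝ) :
    HasDerivAt (fun s' => torusPhi' B₀ μ s' t)
      (1 + (μ / 2) * Real.cos s * (Real.exp ((B₀ - 1) * t) - Real.exp (-((B₀ + 1) * t)))) s := by
  unfold torusPhi'
  exact (hasDerivAt_id s).add (((Real.hasDerivAt_sin s).const_mul (μ / 2)).mul_const _)

theorem hasDerivAt_torusZ'_left (B₀ μ s t : ℝ) :
    HasDerivAt (fun s' => torusZ' B₀ μ s' t)
      ((μ / 2) * -Real.sin s * (Real.exp ((B₀ - 1) * t) + Real.exp (-((B₀ + 1) * t)))) s := by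
  unfold torusZ'
  exact (((Real.hasDerivAt_cos s).const_mul (μ / 2)).mul_const _).const_add _

theorem hasDerivAt_exp_const_mul (a t : ℝ) :
    HasDerivAt (fun t' => Real.exp (a * t')) (a * Real.exp (a * t)) t := by
  simpa [mul_comm] using ((hasDerivAt_id t).const_mul a).exp

theorem hasDerivAt_exp_neg_const_mul (b t : ℝ) :
    HasDerivAt (fun t' => Real.exp (-(b * t'))) (-(b * Real.exp (-(b * t)))) t := by
  simpa only [neg_mul] using hasDerivAt_exp_const_mul (-b) t

theorem hasDerivAt_torusPhi'_right (B₀ μ s t : ℝ) :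
    HasDerivAt (fun t' => torusPhi' B₀ μ s t')
      ((μ / 2) * Real.sin s * ((B₀ - 1) * Real.exp ((B₀ - 1) * t)
        - -((B₀ + 1) * Real.exp (-((B₀ + 1) * t))))) t := by
  unfold torusPhi'
  exact (((hasDerivAt_exp_const_mul _ t).sub
    (hasDerivAt_exp_neg_const_mul _ t)).const_mul _).const_add _

theorem hasDerivAt_torusZ'_right (B₀ μ s t : ℝ) :
    HasDerivAt (fun t' => torusZ' B₀ μ s t')
      (B₀ + (μ / 2) * Real.cos s * ((B₀ - 1) * Real.exp ((B₀ - 1) * t)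
        + -((B₀ + 1) * Real.exp (-((B₀ + 1) * t))))) t := by
  unfold torusZ'
  exact (hasDerivAt_const_mul B₀).add
    (((hasDerivAt_exp_const_mul _ t).add (hasDerivAt_exp_neg_const_mul _ t)).const_mul _)

/-- The integral over a period of a trigonometric polynomial of degree two. -/
theorem integral_sin_sq_add_cos_sq_add_cos_add_const (a b c d : ℝ) :
    ∫ s in (0:ℝ)..(2 * Real.pi),
      (a * Real.sin s ^ 2 + b * Real.cos s ^ 2 + c * Real.cos s + d)
        = Real.pi * (a + b + 2 * d) := by
  have h (f : ℝ → ℝ) (hf : Continuous f) :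
      IntervalIntegrable f MeasureTheory.volume 0 (2 * Real.pi) := hf.intervalIntegrable _ _
  rw [intervalIntegral.integral_add (h _ (by fun_prop)) (h _ (by fun_prop)),
    intervalIntegral.integral_add (h _ (by fun_prop)) (h _ (by fun_prop)),
    intervalIntegral.integral_add (h _ (by fun_prop)) (h _ (by fun_prop))]
  simp only [intervalIntegral.integral_const_mul, integral_sin_sq, integral_cos_sq, integral_cos,
    intervalIntegral.integral_const, Real.sin_two_pi, Real.cos_two_pi, Real.sin_zero,
    Real.cos_zero, smul_eq_mul]
  ring

/-- The integral of the magnetic term over the loop at a fixed flow time. -/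
theorem integral_torus_magnetic_term (B₀ μ t : ℝ) :
    ∫ s in (0:ℝ)..(2 * Real.pi),
        B₀ * (deriv (fun s' => torusZ' B₀ μ s' t) s * deriv (fun t' => torusPhi' B₀ μ s t') t
          - deriv (fun t' => torusZ' B₀ μ s t') t * deriv (fun s' => torusPhi' B₀ μ s' t) s)
      = -(2 * Real.pi * B₀ ^ 2) - B₀ * (Real.pi * μ ^ 2 / 4) *
          (2 * (B₀ - 1) * Real.exp ((B₀ - 1) * t) ^ 2
            + 2 * (B₀ + 1) * Real.exp (-((B₀ + 1) * t)) ^ 2) := by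
  simp only [(hasDerivAt_torusPhi'_left _ _ _ _).deriv, (hasDerivAt_torusZ'_left _ _ _ _).deriv,
    (hasDerivAt_torusPhi'_right _ _ _ _).deriv, (hasDerivAt_torusZ'_right _ _ _ _).deriv]
  generalize Real.exp ((B₀ - 1) * t) = E
  generalize Real.exp (-((B₀ + 1) * t)) = F
  have h := integral_sin_sq_add_cos_sq_add_cos_add_const
    (-(B₀ * (μ / 2) ^ 2 * (E + F) * ((B₀ - 1) * E + (B₀ + 1) * F)))
    (-(B₀ * (μ / 2) ^ 2 * (E - F) * ((B₀ - 1) * E - (B₀ + 1) * F)))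
    (-(B₀ * (μ / 2) * (B₀ * (E - F) + ((B₀ - 1) * E - (B₀ + 1) * F)))) (-(B₀ ^ 2))
  trans
  · refine Eq.trans (intervalIntegral.integral_congr fun s _ => ?_) h
    ring
  · ring

/-- the magnetic term in the energy identity for the torus heat flow with
non-contractible initial curve evaluates to the stated closed form. -/
theorem statement11 (B₀ μ T : ℝ) (hμ : 0 < μ) (hT : 0 < T) :
    (∫ t in (0:ℝ)..T, ∫ s in (0:ℝ)..(2 * Real.pi),
        B₀ * (deriv (fun s' => torusZ' B₀ μ s' t) s * deriv (fun t' => torusPhi' B₀ μ s t') t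
          - deriv (fun t' => torusZ' B₀ μ s t') t * deriv (fun s' => torusPhi' B₀ μ s' t) s))
      = -(2 * Real.pi * B₀ ^ 2 * T)
        + B₀ * (Real.pi * μ ^ 2 / 4) *
            (Real.exp (-2 * T * (1 + B₀)) - Real.exp (-2 * T * (1 - B₀))) := by
  simp only [integral_torus_magnetic_term]
  have hderiv (t : ℝ) : HasDerivAt
      (fun t => -(2 * Real.pi * B₀ ^ 2) * t - B₀ * (Real.pi * μ ^ 2 / 4) *
        (Real.exp ((B₀ - 1) * t) ^ 2 - Real.exp (-((B₀ + 1) * t)) ^ 2))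
      (-(2 * Real.pi * B₀ ^ 2) - B₀ * (Real.pi * μ ^ 2 / 4) *
          (2 * (B₀ - 1) * Real.exp ((B₀ - 1) * t) ^ 2
            + 2 * (B₀ + 1) * Real.exp (-((B₀ + 1) * t)) ^ 2)) t := by
    refine (((hasDerivAt_id t).const_mul (-(2 * Real.pi * B₀ ^ 2))).sub
      ((((hasDerivAt_exp_const_mul (B₀ - 1) t).pow 2).sub
        ((hasDerivAt_exp_neg_const_mul (B₀ + 1) t).pow 2)).const_mul
          (B₀ * (Real.pi * μ ^ 2 / 4)))).congr_deriv ?_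
    push_cast
    ring
  rw [intervalIntegral.integral_eq_sub_of_hasDerivAt (fun t _ => hderiv t)
    (Continuous.intervalIntegrable (by fun_prop) _ _)]
  have h₁ : Real.exp (-2 * T * (1 + B₀)) = Real.exp (-((B₀ + 1) * T)) ^ 2 := by
    rw [← Real.exp_nat_mul]
    congr 1
    push_cast
    ring
  have h₂ : Real.exp (-2 * T * (1 - B₀)) = Real.exp ((B₀ - 1) * T) ^ 2 := by
    rw [← Real.exp_nat_mul]
    congr 1
    push_cast
    ring
  rw [h₁, h₂]
  simp only [mul_zero, neg_zero, Real.exp_zero]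
  ring
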